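/- Let χ be an irreducible complex character of G with χ^b ≠ χ, and let ψ be an irreducible complex character of Ĝ such that χ is a constituent of the restriction ψ|_G. Then: (i) ψ|_G = χ + χ^b; (ii) ψ is the unique irreducible character of Ĝ whose restriction to G contains χ, and ε⊗ψ = ψ; (iii) FŜ(ψ) = F(χ) + F♯(χ). -/

import Mathlib

open scoped Classical

/-- `χ` is the character of an irreducible complex representation of `G`. -/
def IsIrrChar (G : Type) [Group G] (χ : G → ℂ) : Prop :=
  ∃ V : FDRep ℂ G, CategoryTheory.Simple V ∧ χ = V.character

/-- The Frobenius–Schur indicator of a function `χ` on a finite group `G`. -/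
noncomputable def FS (G : Type) [Group G] [Finite G] (χ : G → ℂ) : ℂ :=
  (∑ᶠ g : G, χ (g ^ 2)) / (Nat.card G : ℂ)

theorem conj_mem_of_index_two {Ghat : Type} [Group Ghat] {G : Subgroup Ghat} (h2 : G.index = 2)
    {g : Ghat} (hg : g ∈ G) (x : Ghat) : x * g * x⁻¹ ∈ G := by
  rw [Subgroup.mul_mem_iff_of_index_two h2, Subgroup.mul_mem_iff_of_index_two h2]
  simp [hg, Subgroup.inv_mem_iff]

/-- The twisted Frobenius–Schur indicator, summing over the coset `Ghat \ G`. -/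
noncomputable def FSsharp {Ghat : Type} [Group Ghat] [Finite Ghat] (G : Subgroup Ghat)
    (h2 : G.index = 2) (χ : ↥G → ℂ) : ℂ :=
  (∑ᶠ g ∈ {g : Ghat | g ∉ G}, χ ⟨g ^ 2, Subgroup.sq_mem_of_index_two h2 g⟩) / (Nat.card ↥G : ℂ)

/-- `χ^a`, the complex conjugate character. -/
def aChar {G : Type} [Group G] (χ : G → ℂ) : G → ℂ := fun g => starRingEnd ℂ (χ g)

/-- `χ^b : g ↦ χ(x g x⁻¹)`. -/
def bChar {Ghat : Type} [Group Ghat] {G : Subgroup Ghat} (h2 : G.index = 2) (x : Ghat)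
    (χ : ↥G → ℂ) : ↥G → ℂ :=
  fun g => χ ⟨x * ↑g * x⁻¹, conj_mem_of_index_two h2 g.2 x⟩

/-- `χ^c = conj(χ^b)`. -/
def cChar {Ghat : Type} [Group Ghat] {G : Subgroup Ghat} (h2 : G.index = 2) (x : Ghat)
    (χ : ↥G → ℂ) : ↥G → ℂ := aChar (bChar h2 x χ)

/-- `K` is a conjugacy class of `G`. -/
def IsConjClass (G : Type) [Group G] (K : Set G) : Prop := ∃ g : G, K = {h | IsConj g h}

/-- `K^b = xKx⁻¹`. -/
def bClass {Ghat : Type} [Group Ghat] {G : Subgroup Ghat} (h2 : G.index = 2) (x : Ghat)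
    (K : Set ↥G) : Set ↥G :=
  (fun g : ↥G => (⟨x * ↑g * x⁻¹, conj_mem_of_index_two h2 g.2 x⟩ : ↥G)) '' K

open Module in
/-- The inverse of an endomorphism of finite order has complex conjugate trace. -/
theorem trace_eq_conj_trace_of_pow_eq_one {V : Type*} [AddCommGroup V] [Module ℂ V]
    [FiniteDimensional ℂ V] {f g : End ℂ V} {n : ℕ} (hn : n ≠ 0) (hf : f ^ n = 1)
    (hgf : g * f = 1) :
    LinearMap.trace ℂ V g = starRingEnd ℂ (LinearMap.trace ℂ V f) := by
  have hss : f.IsSemisimple := by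
    refine End.isSemisimple_of_squarefree_aeval_eq_zero
      (p := (Polynomial.X ^ n - Polynomial.C 1 : Polynomial ℂ)) ?_ (by simp [hf])
    exact (Polynomial.separable_X_pow_sub_C 1 (by exact_mod_cast hn) one_ne_zero).squarefree
  have hint : DirectSum.IsInternal f.eigenspace :=
    (DirectSum.isInternal_submodule_iff_iSupIndep_and_iSup_eq_top _).2
      ⟨f.eigenspaces_iSupIndep, hss.iSup_eigenspace_eq_top⟩
  have hfin : {μ | f.eigenspace μ ≠ ⊥}.Finite :=
    WellFoundedGT.finite_ne_bot_of_iSupIndep f.eigenspaces_iSupIndep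
  have hfpow (μ : ℂ) (v : V) (hv : v ∈ f.eigenspace μ) (k : ℕ) : (f ^ k) v = μ ^ k • v := by
    induction k with
    | zero => simp
    | succ k ih => rw [pow_succ, End.mul_apply, End.mem_eigenspace_iff.1 hv, map_smul, ih,
        smul_smul, pow_succ']
  have hpow (μ : ℂ) (hμ : f.eigenspace μ ≠ ⊥) : μ ^ n = 1 := by
    obtain ⟨v, hv, hv0⟩ := Submodule.exists_mem_ne_zero_of_ne_bot hμ
    have h := hfpow μ v hv n
    rw [hf, End.one_apply] at h
    refine smul_left_injective ℂ hv0 ?_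
    simp [← h]
  have hmul (μ : ℂ) (v : V) (hv : v ∈ f.eigenspace μ) : v = μ • g v := by
    rw [← map_smul, ← End.mem_eigenspace_iff.1 hv, ← End.mul_apply, hgf, End.one_apply]
  have hginv (μ : ℂ) (v : V) (hv : v ∈ f.eigenspace μ) : g v = (starRingEnd ℂ μ) • v := by
    rcases eq_or_ne v 0 with rfl | hv0
    · simp
    have hμ := hpow μ (Submodule.ne_bot_iff _ |>.2 ⟨v, hv, hv0⟩)
    have hnorm : starRingEnd ℂ μ * μ = 1 := by
      rw [← Complex.normSq_eq_conj_mul_self, Complex.normSq_eq_norm_sq,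
        Complex.norm_eq_one_of_pow_eq_one hμ hn]
      simp
    conv_rhs => rw [hmul μ v hv, smul_smul, hnorm, one_smul]
  have hfm (μ : ℂ) : Set.MapsTo f (f.eigenspace μ) (f.eigenspace μ) := fun v hv => by
    rw [SetLike.mem_coe, End.mem_eigenspace_iff.1 hv]
    exact Submodule.smul_mem _ _ hv
  have hgm (μ : ℂ) : Set.MapsTo g (f.eigenspace μ) (f.eigenspace μ) := fun v hv => by
    rw [SetLike.mem_coe, hginv μ v hv]
    exact Submodule.smul_mem _ _ hv
  rw [LinearMap.trace_eq_sum_trace_restrict' hint hfin hfm,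
    LinearMap.trace_eq_sum_trace_restrict' hint hfin hgm, map_sum]
  refine Finset.sum_congr rfl fun μ _ => ?_
  have h1 : f.restrict (hfm μ) = μ • LinearMap.id := by
    ext ⟨v, hv⟩
    exact End.mem_eigenspace_iff.1 hv
  have h2 : g.restrict (hgm μ) = starRingEnd ℂ μ • LinearMap.id := by
    ext ⟨v, hv⟩
    exact hginv μ v hv
  rw [h1, h2]
  simp

namespace IsIrrChar

variable {H : Type} [Group H] {χ ψ : H → ℂ}

theorem apply_inv [Finite H] (hχ : IsIrrChar H χ) (g : H) : χ g⁻¹ = starRingEnd ℂ (χ g) := by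
  obtain ⟨V, -, rfl⟩ := hχ
  refine trace_eq_conj_trace_of_pow_eq_one (n := Nat.card H) Nat.card_pos.ne' ?_ ?_
  · rw [← map_pow, pow_card_eq_one', map_one]
  · rw [← map_mul, inv_mul_cancel, map_one]

theorem apply_conj (hχ : IsIrrChar H χ) (g h : H) : χ (h * g * h⁻¹) = χ g := by
  obtain ⟨V, -, rfl⟩ := hχ
  exact V.char_conj g h

/-- The first orthogonality relation. -/
theorem sum_mul_inv [Fintype H] (hχ : IsIrrChar H χ) (hψ : IsIrrChar H ψ) :
    ∑ g, χ g * ψ g⁻¹ = if χ = ψ then (Nat.card H : ℂ) else 0 := by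
  obtain ⟨V, hV, rfl⟩ := hχ
  obtain ⟨W, hW, rfl⟩ := hψ
  have := invertibleOfNonzero (NeZero.ne (Nat.card H : ℂ))
  split_ifs with h
  · rw [← h]
    exact (FDRep.simple_iff_char_is_norm_one V).1 hV
  · have h0 := FDRep.char_orthonormal V W
    rw [if_neg fun ⟨i⟩ => h (FDRep.char_iso i)] at h0
    exact (mul_eq_zero.1 h0).resolve_left (inv_ne_zero (NeZero.ne _))

theorem of_sum_mul_inv [Fintype H] {V : Type} [AddCommGroup V] [Module ℂ V]
    [FiniteDimensional ℂ V] (ρ : Representation ℂ H V)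
    (h : ∑ g, ρ.character g * ρ.character g⁻¹ = Nat.card H) : IsIrrChar H ρ.character :=
  ⟨FDRep.of ρ, (FDRep.simple_iff_char_is_norm_one _).2 h, rfl⟩

theorem comp_mulEquiv [Finite H] (hχ : IsIrrChar H χ) (e : H ≃* H) : IsIrrChar H (χ ∘ e) := by
  have := Fintype.ofFinite H
  have h := hχ.sum_mul_inv hχ
  obtain ⟨V, hV, rfl⟩ := hχ
  refine of_sum_mul_inv (V.ρ.comp e.toMonoidHom) ?_
  rw [if_pos rfl, ← e.toEquiv.sum_comp] at h
  rw [← h]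
  refine Finset.sum_congr rfl fun g _ => ?_
  change V.character (e g) * V.character (e g⁻¹) = V.character (e g) * V.character (e g)⁻¹
  rw [map_inv]

end IsIrrChar

/-- Extension by zero of a function from a subgroup to the whole group. -/
noncomputable def Subgroup.extendZero {K A : Type*} [Group K] [Zero A] (G : Subgroup K)
    (f : G → A) (h : K) : A := if hh : h ∈ G then f ⟨h, hh⟩ else 0

namespace Subgroup

variable {K : Type*} [Group K] {G : Subgroup K}

section Zero

variable {A : Type*} [Zero A] (f : G → A)

@[simp]
theorem extendZero_coe (g : G) : G.extendZero f g = f g := by simp [extendZero]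

theorem extendZero_of_mem {h : K} (hh : h ∈ G) : G.extendZero f h = f ⟨h, hh⟩ := dif_pos hh

theorem extendZero_of_notMem {h : K} (hh : h ∉ G) : G.extendZero f h = 0 := dif_neg hh

end Zero

theorem sum_coe [Fintype K] (F : K → ℂ) : ∑ g : G, F g = ∑ h : K, if h ∈ G then F h else 0 := by
  rw [← Finset.sum_filter]
  exact (Finset.sum_subtype _ (by simp) F).symm

end Subgroup

namespace Representation

variable {K V : Type*} [Group K] {G : Subgroup K} [AddCommGroup V] [Module ℂ V]

theorem extendZero_mul (h2 : G.index = 2) {x : K} (hx : x ∉ G) (ρ : Representation ℂ G V)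
    (a b : K) : G.extendZero ρ (a * b) =
      G.extendZero ρ a * G.extendZero ρ b + G.extendZero ρ (a * x⁻¹) * G.extendZero ρ (x * b) := by
  have key {c d : K} (hc : c ∈ G) (hd : d ∈ G) :
      G.extendZero ρ (c * d) = G.extendZero ρ c * G.extendZero ρ d := by
    lift c to G using hc
    lift d to G using hd
    rw [← Subgroup.coe_mul]
    simp only [Subgroup.extendZero_coe, map_mul]
  have hxb := Subgroup.mul_mem_iff_of_index_two h2 (a := x) (b := b)
  have hax := Subgroup.mul_mem_iff_of_index_two h2 (a := a) (b := x⁻¹)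
  have hab := Subgroup.mul_mem_iff_of_index_two h2 (a := a) (b := b)
  rw [inv_mem_iff] at hax
  by_cases ha : a ∈ G <;> by_cases hb : b ∈ G <;>
    simp only [ha, hb, hx, iff_true, iff_false, not_true_eq_false] at hxb hax hab
  · rw [key ha hb, Subgroup.extendZero_of_notMem _ hxb, mul_zero, add_zero]
  · simp [Subgroup.extendZero_of_notMem, hab, hb, hax]
  · simp [Subgroup.extendZero_of_notMem, hab, ha, hxb]
  · rw [Subgroup.extendZero_of_notMem _ ha, zero_mul, zero_add, ← key hax hxb]
    congr 1
    group

/-- The representation induced from a subgroup of index two, as block matrices with respect to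
the coset representatives `1` and `x`. -/
noncomputable def indOfIndexTwo (h2 : G.index = 2) {x : K} (hx : x ∉ G)
    (ρ : Representation ℂ G V) : Representation ℂ K (V × V) where
  toFun h := LinearMap.prod
    (LinearMap.coprod (G.extendZero ρ h) (G.extendZero ρ (h * x⁻¹)))
    (LinearMap.coprod (G.extendZero ρ (x * h)) (G.extendZero ρ (x * h * x⁻¹)))
  map_one' := by
    have hx' : x⁻¹ ∉ G := by rwa [inv_mem_iff]
    have h1 : G.extendZero ρ 1 = 1 := by
      rw [← G.coe_one, Subgroup.extendZero_coe, map_one]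
    ext v <;> simp [Subgroup.extendZero_of_notMem _ hx, Subgroup.extendZero_of_notMem _ hx', h1]
  map_mul' a b := by
    have h₁ := extendZero_mul h2 hx ρ a b
    have h₂ := extendZero_mul h2 hx ρ a (b * x⁻¹)
    have h₃ := extendZero_mul h2 hx ρ (x * a) b
    have h₄ := extendZero_mul h2 hx ρ (x * a) (b * x⁻¹)
    simp only [← mul_assoc] at h₁ h₂ h₃ h₄
    ext v <;> simp [← mul_assoc, h₁, h₂, h₃, h₄]

theorem character_indOfIndexTwo [FiniteDimensional ℂ V] (h2 : G.index = 2) {x : K} (hx : x ∉ G)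
    (ρ : Representation ℂ G V) (h : K) : (indOfIndexTwo h2 hx ρ).character h =
      G.extendZero ρ.character h + G.extendZero ρ.character (x * h * x⁻¹) := by
  have htrace (k : K) :
      G.extendZero ρ.character k = LinearMap.trace ℂ V (G.extendZero ρ k) := by
    by_cases hk : k ∈ G <;> simp [Subgroup.extendZero, hk, character]
  have hdecomp : indOfIndexTwo h2 hx ρ h =
      LinearMap.prodMap (G.extendZero ρ h) (G.extendZero ρ (x * h * x⁻¹)) +
      (LinearMap.inl ℂ V V ∘ₗ G.extendZero ρ (h * x⁻¹) ∘ₗ LinearMap.snd ℂ V V +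
        LinearMap.inr ℂ V V ∘ₗ G.extendZero ρ (x * h) ∘ₗ LinearMap.fst ℂ V V) := by
    ext v <;> simp [indOfIndexTwo]
  rw [character, hdecomp, map_add, map_add, LinearMap.trace_prodMap',
    LinearMap.trace_comp_comm', LinearMap.trace_comp_comm' _ (LinearMap.inr ℂ V V),
    LinearMap.comp_assoc, LinearMap.comp_assoc, LinearMap.snd_comp_inl, LinearMap.fst_comp_inr]
  simp [htrace]

end Representation

section IndexTwo

variable {Ghat : Type} [Group Ghat] {G : Subgroup Ghat}

theorem natCard_eq_two_mul_of_index_two (h2 : G.index = 2) :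
    (Nat.card Ghat : ℂ) = 2 * Nat.card G := by
  rw [← G.card_mul_index, h2]
  push_cast
  ring

theorem IsIrrChar.bChar [Finite Ghat] (h2 : G.index = 2) {χ : G → ℂ} (hχ : IsIrrChar G χ)
    (x : Ghat) :
    IsIrrChar G (bChar h2 x χ) := by
  have := Subgroup.normal_of_index_eq_two h2
  exact hχ.comp_mulEquiv (MulAut.conjNormal (H := G) x)

/-- The function induced from `χ` to `Ghat`, when `G` has index two. -/
noncomputable def indChar (x : Ghat) (χ : G → ℂ) (h : Ghat) : ℂ :=
  G.extendZero χ h + G.extendZero χ (x * h * x⁻¹)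

theorem indChar_coe (h2 : G.index = 2) (x : Ghat) (χ : G → ℂ) (g : G) :
    indChar x χ g = χ g + bChar h2 x χ g := by
  rw [indChar, Subgroup.extendZero_coe,
    Subgroup.extendZero_of_mem _ (conj_mem_of_index_two h2 g.2 x), bChar]

theorem indChar_of_notMem (h2 : G.index = 2) (x : Ghat) (χ : G → ℂ) {h : Ghat}
    (hh : h ∉ G) : indChar x χ h = 0 := by
  have := Subgroup.normal_of_index_eq_two h2
  rw [indChar, Subgroup.extendZero_of_notMem _ hh, Subgroup.extendZero_of_notMem, add_zero]
  rwa [← Subgroup.Normal.mem_comm_iff this, inv_mul_cancel_left]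

/-- Clifford theory in index two: inducing a character which is not fixed by the outer
conjugation yields an irreducible character. -/
theorem isIrrChar_indChar [Finite Ghat] (h2 : G.index = 2) {x : Ghat} (hx : x ∉ G)
    {χ : G → ℂ} (hχ : IsIrrChar G χ)
    (hb : bChar h2 x χ ≠ χ) : IsIrrChar Ghat (indChar x χ) := by
  have := Fintype.ofFinite Ghat
  have hχb := IsIrrChar.bChar h2 hχ x
  have hsum : ∑ h, indChar x χ h * indChar x χ h⁻¹ = Nat.card Ghat := by
    calc ∑ h, indChar x χ h * indChar x χ h⁻¹
        = ∑ h, if h ∈ G then indChar x χ h * indChar x χ h⁻¹ else 0 := by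
          refine Finset.sum_congr rfl fun h _ => ?_
          split_ifs with hh
          · rfl
          · rw [indChar_of_notMem h2 x χ hh, zero_mul]
      _ = ∑ g : G, (χ g + bChar h2 x χ g) * (χ g⁻¹ + bChar h2 x χ g⁻¹) := by
          rw [← Subgroup.sum_coe fun h => indChar x χ h * indChar x χ h⁻¹]
          simp only [← Subgroup.coe_inv, indChar_coe h2]
      _ = Nat.card Ghat := by
          simp only [add_mul, mul_add, Finset.sum_add_distrib, hχ.sum_mul_inv hχ,
            hχ.sum_mul_inv hχb, hχb.sum_mul_inv hχ, hχb.sum_mul_inv hχb, if_neg hb, if_neg hb.symm,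
            if_true, natCard_eq_two_mul_of_index_two h2]
          ring
  obtain ⟨V, -, rfl⟩ := hχ
  have hchar : indChar x V.character =
      (Representation.indOfIndexTwo h2 hx V.ρ).character := by
    ext h
    rw [Representation.character_indOfIndexTwo]
    rfl
  rw [hchar] at hsum ⊢
  exact IsIrrChar.of_sum_mul_inv _ hsum

/-- Frobenius reciprocity for irreducible characters in index two. -/
theorem sum_mul_indChar_inv [Fintype Ghat] (x : Ghat) {ψ : Ghat → ℂ} (hψ : IsIrrChar Ghat ψ)
    (χ : G → ℂ) : ∑ h, ψ h * indChar x χ h⁻¹ = 2 * ∑ g : G, ψ g * χ g⁻¹ := by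
  have h1 : ∑ h, ψ h * G.extendZero χ h⁻¹ = ∑ g : G, ψ g * χ g⁻¹ := by
    have := Subgroup.sum_coe (G := G) fun h => ψ h * G.extendZero χ h⁻¹
    simp only [← Subgroup.coe_inv, Subgroup.extendZero_coe] at this
    rw [this]
    refine Finset.sum_congr rfl fun h _ => ?_
    split_ifs with hh
    · rfl
    · rw [Subgroup.extendZero_of_notMem _ (by rwa [inv_mem_iff]), mul_zero]
  have hconj : ∑ h, ψ h * G.extendZero χ (x * h⁻¹ * x⁻¹) = ∑ h, ψ h * G.extendZero χ h⁻¹ := by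
    rw [← (MulAut.conj x).toEquiv.sum_comp fun h => ψ h * G.extendZero χ h⁻¹]
    refine Finset.sum_congr rfl fun h _ => ?_
    have hinv : (x * h * x⁻¹)⁻¹ = x * h⁻¹ * x⁻¹ := by group
    simp [hψ.apply_conj, hinv, -mul_inv_rev]
  simp only [indChar, mul_add, Finset.sum_add_distrib, h1, hconj]
  ring

theorem isIrrChar_constituent_iff_eq_indChar [Finite Ghat] (h2 : G.index = 2) {x : Ghat}
    (hx : x ∉ G) {χ : G → ℂ}
    (hχ : IsIrrChar G χ) (hb : bChar h2 x χ ≠ χ) {ψ : Ghat → ℂ} (hψ : IsIrrChar Ghat ψ) :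
    (∑ᶠ g : G, ψ g * starRingEnd ℂ (χ g)) ≠ 0 ↔ ψ = indChar x χ := by
  have := Fintype.ofFinite Ghat
  have h := sum_mul_indChar_inv x hψ χ
  rw [hψ.sum_mul_inv (isIrrChar_indChar h2 hx hχ hb)] at h
  rw [finsum_eq_sum_of_fintype, Finset.sum_congr rfl fun g _ => by rw [← hχ.apply_inv g]]
  split_ifs at h with heq
  · have hcard : (Nat.card Ghat : ℂ) ≠ 0 := NeZero.ne _
    simp only [heq, iff_true]
    rw [heq] at h
    exact fun h0 => hcard (by rw [h, h0, mul_zero])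
  · simpa [heq] using h.symm

theorem sum_indChar_sq [Fintype Ghat] (h2 : G.index = 2) (x : Ghat) (χ : G → ℂ) :
    ∑ h, indChar x χ (h ^ 2) = 2 * ∑ h : Ghat, χ ⟨h ^ 2, Subgroup.sq_mem_of_index_two h2 h⟩ := by
  have h1 (h : Ghat) : χ ⟨h ^ 2, Subgroup.sq_mem_of_index_two h2 h⟩ = G.extendZero χ (h ^ 2) :=
    (Subgroup.extendZero_of_mem _ _).symm
  simp only [h1, indChar, Finset.sum_add_distrib, two_mul]
  congr 1
  rw [← (MulAut.conj x).toEquiv.sum_comp fun h => G.extendZero χ (h ^ 2)]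
  simp

theorem FS_indChar [Finite Ghat] (h2 : G.index = 2) (x : Ghat) (χ : G → ℂ) :
    FS Ghat (indChar x χ) = FS G χ + FSsharp G h2 χ := by
  have := Fintype.ofFinite Ghat
  have hG : ∑ g : G, χ (g ^ 2) =
      ∑ h : Ghat, if h ∈ G then χ ⟨h ^ 2, Subgroup.sq_mem_of_index_two h2 h⟩ else 0 :=
    Subgroup.sum_coe fun h => χ ⟨h ^ 2, Subgroup.sq_mem_of_index_two h2 h⟩
  have hsharp : ∑ᶠ g ∈ {g : Ghat | g ∉ G}, χ ⟨g ^ 2, Subgroup.sq_mem_of_index_two h2 g⟩ =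
      ∑ h : Ghat, if h ∈ G then 0 else χ ⟨h ^ 2, Subgroup.sq_mem_of_index_two h2 h⟩ := by
    rw [finsum_eq_sum_of_fintype]
    refine Finset.sum_congr rfl fun h _ => ?_
    rw [finsum_eq_if]
    simp only [Set.mem_ofPred_eq, ite_not]
  rw [FS, FS, FSsharp, finsum_eq_sum_of_fintype, finsum_eq_sum_of_fintype, sum_indChar_sq h2,
    ← add_div, hG, hsharp, ← Finset.sum_add_distrib, natCard_eq_two_mul_of_index_two h2,
    mul_div_mul_left _ _ two_ne_zero]
  congr 1
  refine Finset.sum_congr rfl fun h _ => ?_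
  split_ifs <;> simp

end IndexTwo

/-- If `χ^b ≠ χ` and `χ` is a constituent of `ψ|_G`, then `ψ|_G = χ + χ^b`; `ψ` is the
unique irreducible character of `Ĝ` restricting to `χ`, with `ε⊗ψ = ψ`; and
`FŜ(ψ) = F(χ) + F♯(χ)`. -/
theorem induction_b_moved {Ghat : Type} [Group Ghat] [Finite Ghat] (G : Subgroup Ghat)
    (h2 : G.index = 2) (x : Ghat) (hx : x ∉ G)
    (χ : ↥G → ℂ) (hχ : IsIrrChar ↥G χ) (hb : bChar h2 x χ ≠ χ)
    (ψ : Ghat → ℂ) (hψ : IsIrrChar Ghat ψ)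
    (hcons : (∑ᶠ g : ↥G, ψ ↑g * starRingEnd ℂ (χ g)) ≠ 0) :
    (∀ g : ↥G, ψ ↑g = χ g + bChar h2 x χ g) ∧
    (∀ ψ' : Ghat → ℂ, IsIrrChar Ghat ψ' →
      ((∑ᶠ g : ↥G, ψ' ↑g * starRingEnd ℂ (χ g)) ≠ 0 ↔ ψ' = ψ)) ∧
    (fun h => (if h ∈ G then (1 : ℂ) else -1) * ψ h) = ψ ∧
    FS Ghat ψ = FS ↥G χ + FSsharp G h2 χ := by
  obtain rfl := (isIrrChar_constituent_iff_eq_indChar h2 hx hχ hb hψ).1 hcons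
  refine ⟨indChar_coe h2 x χ,
    fun ψ' hψ' => isIrrChar_constituent_iff_eq_indChar h2 hx hχ hb hψ', ?_, FS_indChar h2 x χ⟩
  ext h
  split_ifs with hh
  · rw [one_mul]
  · rw [indChar_of_notMem h2 x χ hh, mul_zero]
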